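/- Let ν be a convex piecewise-linear function certifying a convex subdivision τ of a polytope Δ, and let ν' be any piecewise-linear function on Δ that is convex on each cell of τ. Then for all sufficiently small ε > 0, the function ν + ε·ν' is convex on Δ. -/

import Mathlib

open Set Filter Topology

/-- Every vector in the span of the translate `C - c₀` of a convex set is a nonnegative multiple of
a difference of two points of `C`. -/
lemma Convex.exists_smul_sub_of_mem_span {E : Type*} [AddCommGroup E] [Module ℝ E] {C : Set E}
    (hC : Convex ℝ C) {c₀ : E} (hc₀ : c₀ ∈ C) {v : E}
    (hv : v ∈ Submodule.span ℝ ((fun x => x - c₀) '' C)) :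
    ∃ r : ℝ, 0 ≤ r ∧ ∃ A ∈ C, ∃ B ∈ C, v = r • (A - B) := by
  induction hv using Submodule.span_induction with
  | mem v hv =>
    obtain ⟨x, hx, rfl⟩ := hv
    exact ⟨1, zero_le_one, x, hx, c₀, hc₀, by simp⟩
  | zero => exact ⟨0, le_rfl, c₀, hc₀, c₀, hc₀, by simp⟩
  | add v w _ _ hv hw =>
    obtain ⟨r, hr, A, hA, B, hB, rfl⟩ := hv
    obtain ⟨s, hs, A', hA', B', hB', rfl⟩ := hw
    rcases (add_nonneg hr hs).eq_or_lt with h | h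
    · have hr0 : r = 0 := by linarith
      have hs0 : s = 0 := by linarith
      exact ⟨0, le_rfl, c₀, hc₀, c₀, hc₀, by simp [hr0, hs0]⟩
    · have hsum : r / (r + s) + s / (r + s) = 1 := by field_simp
      refine ⟨r + s, h.le, (r / (r + s)) • A + (s / (r + s)) • A',
        hC hA hA' (by positivity) (by positivity) hsum,
        (r / (r + s)) • B + (s / (r + s)) • B',
        hC hB hB' (by positivity) (by positivity) hsum, ?_⟩
      have h1 : (r + s) * (r / (r + s)) = r := by field_simp
      have h2 : (r + s) * (s / (r + s)) = s := by field_simp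
      simp only [smul_sub, smul_add, smul_smul, h1, h2]
      abel
  | smul k v _ hv =>
    obtain ⟨r, hr, A, hA, B, hB, rfl⟩ := hv
    rcases le_total 0 k with hk | hk
    · exact ⟨k * r, mul_nonneg hk hr, A, hA, B, hB, by rw [smul_smul]⟩
    · refine ⟨-k * r, mul_nonneg (by linarith) hr, B, hB, A, hA, ?_⟩
      rw [smul_smul, ← neg_sub A B, smul_neg, neg_mul, neg_smul, neg_neg]

/-- If a convex function agrees with an affine function on a convex set `C`, and no affine function
extending it from `C` agrees with it outside `C`, then the affine function is a minorant. -/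
lemma ConvexOn.affine_le_of_maximal {E : Type*} [AddCommGroup E] [Module ℝ E] {Δ C : Set E}
    {ν : E → ℝ} (hν : ConvexOn ℝ Δ ν) (hC : Convex ℝ C) (hCΔ : C ⊆ Δ)
    (hmax : ∀ (l : E →ₗ[ℝ] ℝ) (c : ℝ), (∀ x ∈ C, ν x = l x + c) →
      ∀ x ∈ Δ, ν x = l x + c → x ∈ C)
    {l : E →ₗ[ℝ] ℝ} {c : ℝ} (hl : ∀ x ∈ C, ν x = l x + c) {x : E} (hx : x ∈ Δ) :
    l x + c ≤ ν x := by
  by_contra! hlt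
  have hxC : x ∉ C := fun h => hlt.ne (hl x h)
  obtain rfl | ⟨c₀, hc₀⟩ := C.eq_empty_or_nonempty
  · exact hmax 0 (ν x) (by simp) x hx (by simp)
  by_cases hspan : x - c₀ ∈ Submodule.span ℝ ((fun x => x - c₀) '' C)
  · obtain ⟨r, hr, A, hA, B, hB, hAB⟩ := hC.exists_smul_sub_of_mem_span hc₀ hspan
    have hsum : 1 / (1 + r) + r / (1 + r) = 1 := by field_simp
    have h1 : 0 < 1 / (1 + r) := by positivity
    have h2 : 0 ≤ r / (1 + r) := by positivity
    have hmid : (1 / (1 + r)) • x + (r / (1 + r)) • B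
        = (1 / (1 + r)) • c₀ + (r / (1 + r)) • A := by
      rw [eq_add_of_sub_eq hAB, smul_add, smul_smul, one_div_mul_eq_div, smul_sub]
      abel
    have hmem : (1 / (1 + r)) • x + (r / (1 + r)) • B ∈ C :=
      hmid ▸ hC hc₀ hA h1.le h2 hsum
    have hconv := hν.2 hx (hCΔ hB) h1.le h2 hsum
    rw [hl _ hmem, hl B hB] at hconv
    simp only [map_add, map_smul, smul_eq_mul] at hconv
    have := mul_lt_mul_of_pos_left hlt h1
    have hc : 1 / (1 + r) * c + r / (1 + r) * c = c := by rw [← add_mul, hsum, one_mul]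
    linarith
  · obtain ⟨f, hf, hker⟩ := Submodule.exists_le_ker_of_notMem hspan
    have hfC : ∀ y ∈ C, f y = f c₀ := fun y hy => by
      have : f (y - c₀) = 0 := hker (Submodule.subset_span ⟨y, hy, rfl⟩)
      rwa [map_sub, sub_eq_zero] at this
    have hf' : f x - f c₀ ≠ 0 := by rwa [← map_sub]
    set k := (ν x - (l x + c)) / (f x - f c₀) with hk
    refine hxC (hmax (l + k • f) (c - k * f c₀) (fun y hy => ?_) x hx ?_)
    · simp [hl y hy, hfC y hy]
    · have : k * (f x - f c₀) = ν x - (l x + c) := div_mul_cancel₀ _ hf'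
      simp only [LinearMap.add_apply, LinearMap.smul_apply, smul_eq_mul]
      linarith

/-- Finitely many nonnegative concave functions, none identically zero on a convex set, have a
common point of positivity. -/
lemma Convex.exists_forall_le_of_concaveOn {E ι : Type*} [AddCommGroup E] [Module ℝ E]
    {C : Set E} (hC : Convex ℝ C) (hne : C.Nonempty) (S : Finset ι) (h : ι → E → ℝ)
    (hconc : ∀ i ∈ S, ConcaveOn ℝ C (h i)) (hnonneg : ∀ i ∈ S, ∀ x ∈ C, 0 ≤ h i x)
    (hpos : ∀ i ∈ S, ∃ x ∈ C, 0 < h i x) :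
    ∃ p ∈ C, ∃ δ : ℝ, 0 < δ ∧ ∀ i ∈ S, δ ≤ h i p := by
  classical
  induction S using Finset.induction_on with
  | empty => exact ⟨hne.some, hne.some_mem, 1, one_pos, by simp⟩
  | insert j S _ ih =>
    simp only [Finset.forall_mem_insert] at hconc hnonneg hpos
    obtain ⟨p, hp, δ, hδ, hpδ⟩ := ih hconc.2 hnonneg.2 hpos.2
    obtain ⟨q, hq, hjq⟩ := hpos.1
    have hhalf : (1 / 2 : ℝ) + 1 / 2 = 1 := by norm_num
    refine ⟨(1 / 2 : ℝ) • p + (1 / 2 : ℝ) • q,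
      hC hp hq (by norm_num) (by norm_num) hhalf, min (δ / 2) (h j q / 2),
      lt_min (by linarith) (by linarith), ?_⟩
    simp only [Finset.forall_mem_insert]
    refine ⟨?_, fun i hi => ?_⟩
    · have h1 := hconc.1.2 hp hq (by norm_num) (by norm_num) hhalf
      have h2 := hnonneg.1 p hp
      simp only [smul_eq_mul] at h1
      exact (min_le_right _ _).trans (by linarith)
    · have h1 := (hconc.2 i hi).2 hp hq (by norm_num) (by norm_num) hhalf
      have h2 := hnonneg.2 i hi q hq
      have h3 := hpδ i hi
      simp only [smul_eq_mul] at h1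
      exact (min_le_left _ _).trans (by linarith)

/-- A Hoffman-type error bound: if `ν` is the maximum of the affine functions `l i + c i`, each
attaining it exactly on the cell `C i`, then every point can be moved into a given cell `C j`
towards a fixed point of it, by an amount controlled by the gap `ν - (l j + c j)`. -/
lemma exists_lineMap_mem_cell {E ι : Type*} [AddCommGroup E] [Module ℝ E] {Δ : Set E}
    (hΔ : Convex ℝ Δ) (S : Finset ι) (C : ι → Set E) (hcover : ∀ x ∈ Δ, ∃ i ∈ S, x ∈ C i)
    (hsub : ∀ i ∈ S, C i ⊆ Δ) {ν : E → ℝ} (l : ι → E →ₗ[ℝ] ℝ) (c : ι → ℝ)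
    (heq : ∀ i ∈ S, ∀ x ∈ C i, ν x = l i x + c i)
    (hle : ∀ i ∈ S, ∀ x ∈ Δ, l i x + c i ≤ ν x)
    {j : ι} (hj : j ∈ S) (hCj : Convex ℝ (C j)) (hne : (C j).Nonempty)
    (hmax : ∀ (l : E →ₗ[ℝ] ℝ) (c : ℝ), (∀ x ∈ C j, ν x = l x + c) →
      ∀ x ∈ Δ, ν x = l x + c → x ∈ C j) :
    ∃ p ∈ C j, ∃ δ : ℝ, 0 < δ ∧ ∀ u ∈ Δ, ∃ t : ℝ, 0 ≤ t ∧ t ≤ 1 ∧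
      t * δ ≤ ν u - (l j u + c j) ∧ (1 - t) • u + t • p ∈ C j := by
  classical
  have hgap : ∀ i ∈ S, ∀ x ∈ C j, 0 ≤ (l j - l i) x + (c j - c i) := fun i hi x hx => by
    have h1 := hle i hi x (hsub j hj hx)
    rw [heq j hj x hx] at h1
    simp only [LinearMap.sub_apply]
    linarith
  obtain ⟨p, hp, δ, hδ, hpδ⟩ := hCj.exists_forall_le_of_concaveOn hne
    (S.filter fun i => ¬ C i ⊆ C j) (fun i x => (l j - l i) x + (c j - c i))
    (fun i _ => ((l j - l i).concaveOn hCj).add_const _)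
    (fun i hi => hgap i (Finset.mem_filter.1 hi).1)
    (fun i hi => by
      obtain ⟨hiS, hi⟩ := Finset.mem_filter.1 hi
      by_contra! hcon
      refine hi fun x hx => hmax (l i) (c i) (fun y hy => ?_) x (hsub i hiS hx) (heq i hiS x hx)
      have h1 := (hcon y hy).antisymm (hgap i hiS y hy)
      rw [heq j hj y hy]
      simp only [LinearMap.sub_apply] at h1
      linarith)
  refine ⟨p, hp, δ, hδ, fun u hu => ?_⟩
  set g := ν u - (l j u + c j) with hg
  have hg0 : 0 ≤ g := sub_nonneg.2 (hle j hj u hu)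
  have hgδ : 0 < g + δ := by linarith
  have ht1 : g / (g + δ) ≤ 1 := (div_le_one hgδ).2 (by linarith)
  have ht0 : 0 ≤ g / (g + δ) := by positivity
  have htδ : g / (g + δ) * δ = (1 - g / (g + δ)) * g := by field_simp; ring
  set t := g / (g + δ) with ht
  have hz : (1 - t) • u + t • p ∈ Δ :=
    hΔ hu (hsub j hj hp) (by linarith) ht0 (by ring)
  refine ⟨t, ht0, ht1, ?_, ?_⟩
  · rw [htδ]
    nlinarith
  · obtain ⟨i, hi, hzi⟩ := hcover _ hz
    by_cases hij : C i ⊆ C j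
    · exact hij hzi
    refine hmax (l j) (c j) (heq j hj) _ hz (le_antisymm ?_ (hle j hj _ hz))
    rw [heq i hi _ hzi]
    have h1 := hpδ i (Finset.mem_filter.2 ⟨hi, hij⟩)
    have h2 := hle i hi u hu
    have h3 : l i u + c i - (l j u + c j) ≤ g := by linarith
    have h4 := mul_le_mul_of_nonneg_left h3 (sub_nonneg.2 ht1)
    have h5 := mul_le_mul_of_nonneg_left h1 ht0
    simp only [LinearMap.sub_apply, map_add, map_smul, smul_eq_mul] at h5 ⊢
    linarith

/-- A continuous function on a convex set that is affine on each piece of a finite cover is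
Lipschitz. -/
lemma exists_lipschitz_of_piecewise_affine {E : Type*} [NormedAddCommGroup E] [NormedSpace ℝ E]
    [FiniteDimensional ℝ E] {Δ : Set E} (hΔ : Convex ℝ Δ) {f : E → ℝ} (hf : ContinuousOn f Δ)
    (σ : Finset (Set E)) (hcover : ∀ x ∈ Δ, ∃ D ∈ σ, x ∈ D)
    (haff : ∀ D ∈ σ, ∃ (l : E →ₗ[ℝ] ℝ) (c : ℝ), ∀ x ∈ D, f x = l x + c) :
    ∃ L : ℝ, 0 ≤ L ∧ ∀ x ∈ Δ, ∀ y ∈ Δ, |f y - f x| ≤ L * ‖y - x‖ := by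
  have haff' : ∀ D, ∃ (l : E →ₗ[ℝ] ℝ) (c : ℝ), D ∈ σ → ∀ x ∈ D, f x = l x + c := fun D => by
    by_cases hD : D ∈ σ
    · obtain ⟨l, c, h⟩ := haff D hD
      exact ⟨l, c, fun _ => h⟩
    · exact ⟨0, 0, fun h => absurd h hD⟩
  choose l c hlc using haff'
  set M : ℝ := ∑ D ∈ σ, ‖(l D).toContinuousLinearMap‖ with hM
  have hM0 : 0 ≤ M := Finset.sum_nonneg fun _ _ => norm_nonneg _
  have hlM : ∀ D ∈ σ, ∀ v, |l D v| ≤ M * ‖v‖ := fun D hD v =>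
    ((l D).toContinuousLinearMap.le_opNorm v).trans
      (mul_le_mul_of_nonneg_right (Finset.single_le_sum
        (f := fun D => ‖(l D).toContinuousLinearMap‖) (fun _ _ => norm_nonneg _) hD)
        (norm_nonneg v))
  have key : ∀ x ∈ Δ, ∀ y ∈ Δ, f y - f x ≤ M * ‖y - x‖ := fun x hx y hy => by
    set γ : ℝ → E := fun s => x + s • (y - x) with hγ
    have hγc : Continuous γ := by fun_prop
    have hγΔ : MapsTo γ (Icc 0 1) Δ := fun s hs => hΔ.add_smul_sub_mem hx hy hs
    have hφ : ContinuousOn (f ∘ γ) (Icc 0 1) := hf.comp hγc.continuousOn hγΔ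
    have hbound : ∀ s ∈ Icc (0 : ℝ) 1, (f ∘ γ) s ≤ f x + M * ‖y - x‖ * s := by
      refine fun s hs => image_le_of_liminf_slope_right_le_deriv_boundary
        (B := fun s => f x + M * ‖y - x‖ * s) (B' := fun _ => M * ‖y - x‖)
        hφ (by simp [hγ]) (by fun_prop) (fun t _ => ?_) (fun t ht r hr => ?_) hs
      · simpa using (((hasDerivAt_id t).const_mul (M * ‖y - x‖)).const_add (f x)).hasDerivWithinAt
      have hIcc : Icc (0 : ℝ) 1 ∈ 𝓝[>] t := Icc_mem_nhdsGT_of_mem ht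
      obtain ⟨D, hD, hfreq⟩ : ∃ D ∈ σ, ∃ᶠ z in 𝓝[>] t, γ z ∈ D := by
        by_contra! hcon
        have hev : ∀ᶠ z in 𝓝[>] t, ∀ D ∈ σ, γ z ∉ D :=
          (Filter.eventually_all_finset σ).2 hcon
        obtain ⟨z, hz, hzI⟩ := (hev.and hIcc).exists
        obtain ⟨D, hD, hzD⟩ := hcover _ (hγΔ hzI)
        exact hz D hD hzD
      have ht' : f (γ t) - (l D (γ t) + c D) = 0 := by
        have hl : Continuous (l D) := (l D).continuous_of_finiteDimensional
        have htend : Tendsto (fun z => f (γ z) - (l D (γ z) + c D)) (𝓝[>] t)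
            (𝓝 (f (γ t) - (l D (γ t) + c D))) :=
          ((hφ t (Ico_subset_Icc_self ht)).mono_of_mem_nhdsWithin hIcc).sub
            ((hl.comp hγc).add continuous_const).continuousWithinAt
        exact isClosed_singleton.mem_of_frequently_of_tendsto
          (hfreq.mono fun z hz => by simp [hlc D hD _ hz]) htend
      refine (hfreq.and_eventually self_mem_nhdsWithin).mono fun z ⟨hzD, hz⟩ => ?_
      have hzt : 0 < z - t := sub_pos.2 hz
      have hdiff : f (γ z) - f (γ t) = (z - t) * l D (y - x) := by
        rw [hlc D hD _ hzD, sub_eq_zero.1 ht']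
        simp only [hγ, map_add, map_smul, smul_eq_mul]
        ring
      rw [slope_def_field, Function.comp_apply, Function.comp_apply, hdiff,
        mul_div_cancel_left₀ _ hzt.ne']
      exact ((le_abs_self _).trans (hlM D hD _)).trans_lt hr
    have := hbound 1 (by simp)
    simp only [hγ, Function.comp_apply, one_smul, add_sub_cancel, mul_one] at this
    linarith
  refine ⟨M, hM0, fun x hx y hy => abs_sub_le_iff.2 ⟨key x hx y hy, ?_⟩⟩
  rw [norm_sub_rev]
  exact key y hy x hx

/-- Let ν be a convex piecewise-linear function certifying a convex subdivision τ of a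
compact convex polytope Δ (ν is convex, affine on each cell of τ, and each affine
piece of ν agrees with ν only on its cell), and let ν' be continuous, piecewise
linear with domains of linearity refining τ, and convex on each cell of τ.
Then for all sufficiently small ε > 0 the function ν + ε·ν' is convex on Δ. -/
theorem stmt_9 (d : ℕ) (Δ : Set (Fin d → ℝ)) (hΔconv : Convex ℝ Δ) (hΔcomp : IsCompact Δ)
    (τ : Finset (Set (Fin d → ℝ)))
    (hcover : (⋃ C ∈ τ, C) = Δ)
    (hcells : ∀ C ∈ τ, Convex ℝ C)
    (ν ν' : (Fin d → ℝ) → ℝ)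
    (hν : ConvexOn ℝ Δ ν)
    (hνaff : ∀ C ∈ τ, ∃ (l : (Fin d → ℝ) →ₗ[ℝ] ℝ) (c : ℝ), ∀ x ∈ C, ν x = l x + c)
    (hνmax : ∀ C ∈ τ, ∀ (l : (Fin d → ℝ) →ₗ[ℝ] ℝ) (c : ℝ),
      (∀ x ∈ C, ν x = l x + c) → ∀ x ∈ Δ, ν x = l x + c → x ∈ C)
    (hν'cont : ContinuousOn ν' Δ)
    (hν'pl : ∃ σ : Finset (Set (Fin d → ℝ)), (⋃ D ∈ σ, D) = Δ ∧
      (∀ D ∈ σ, ∃ C ∈ τ, D ⊆ C) ∧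
      (∀ D ∈ σ, ∃ (l : (Fin d → ℝ) →ₗ[ℝ] ℝ) (c : ℝ), ∀ x ∈ D, ν' x = l x + c))
    (hν'conv : ∀ C ∈ τ, ConvexOn ℝ C ν') :
    ∃ ε₀ > (0:ℝ), ∀ ε : ℝ, 0 < ε → ε < ε₀ →
      ConvexOn ℝ Δ (fun x => ν x + ε * ν' x) := by
  classical
  obtain ⟨σ, hσcover, -, hσaff⟩ := hν'pl
  have hτΔ : ∀ C ∈ τ, C ⊆ Δ := fun C hC x hx => hcover ▸ mem_biUnion hC hx
  have hτcover : ∀ x ∈ Δ, ∃ C ∈ τ, x ∈ C := fun x hx => by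
    rw [← hcover] at hx
    simpa using hx
  obtain ⟨L, hL, hlip⟩ := exists_lipschitz_of_piecewise_affine hΔconv hν'cont σ
    (fun x hx => by rw [← hσcover] at hx; simpa using hx) hσaff
  obtain ⟨R, hR⟩ := hΔcomp.isBounded.exists_norm_le
  have haff' : ∀ C, ∃ (l : (Fin d → ℝ) →ₗ[ℝ] ℝ) (c : ℝ), C ∈ τ → ∀ x ∈ C, ν x = l x + c :=
    fun C => by
      by_cases hC : C ∈ τ
      · obtain ⟨l, c, h⟩ := hνaff C hC
        exact ⟨l, c, fun _ => h⟩
      · exact ⟨0, 0, fun h => absurd h hC⟩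
  choose l c hlc using haff'
  have hle : ∀ C ∈ τ, ∀ x ∈ Δ, l C x + c C ≤ ν x := fun C hC x hx =>
    hν.affine_le_of_maximal (hcells C hC) (hτΔ C hC) (hνmax C hC) (hlc C hC) hx
  have hcell : ∀ C, ∃ δ : ℝ, 0 < δ ∧ (C ∈ τ → C.Nonempty → ∃ p ∈ C, ∀ u ∈ Δ, ∃ t : ℝ,
      0 ≤ t ∧ t ≤ 1 ∧ t * δ ≤ ν u - (l C u + c C) ∧ (1 - t) • u + t • p ∈ C) := fun C => by
    by_cases hC : C ∈ τ ∧ C.Nonempty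
    · obtain ⟨p, hp, δ, hδ, h⟩ := exists_lineMap_mem_cell hΔconv τ id hτcover hτΔ l c hlc hle
        hC.1 (hcells C hC.1) hC.2 (hνmax C hC.1)
      exact ⟨δ, hδ, fun _ _ => ⟨p, hp, h⟩⟩
    · exact ⟨1, one_pos, fun h h' => absurd ⟨h, h'⟩ hC⟩
  choose δ hδ hcell using hcell
  obtain ⟨δ₀, hδ₀, hδ₀le⟩ : ∃ δ₀ : ℝ, 0 < δ₀ ∧ ∀ C ∈ τ, δ₀ ≤ δ C := by
    obtain rfl | hne := τ.eq_empty_or_nonempty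
    · exact ⟨1, one_pos, by simp⟩
    · obtain ⟨C, hC, hmin⟩ := τ.exists_min_image δ hne
      exact ⟨δ C, hδ C, hmin⟩
  set K : ℝ := 2 * (L * (2 * |R|)) + 1 with hK
  have hK0 : 0 < K := by positivity
  refine ⟨δ₀ / K, by positivity, fun ε hε hεlt => ⟨hΔconv, fun u hu v hv a b ha hb hab => ?_⟩⟩
  have hεK : ε * K < δ₀ := (lt_div_iff₀ hK0).1 hεlt
  set x := a • u + b • v with hx
  have hxΔ : x ∈ Δ := hΔconv hu hv ha hb hab
  obtain ⟨C, hC, hxC⟩ := hτcover x hxΔ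
  obtain ⟨p, hp, hmove⟩ := hcell C hC ⟨x, hxC⟩
  have hpull : ∀ u ∈ Δ, ∃ z ∈ C, ∃ t : ℝ, 0 ≤ t ∧ t * δ₀ ≤ ν u - (l C u + c C) ∧
      ‖z - u‖ ≤ t * (2 * |R|) := fun u hu => by
    obtain ⟨t, ht0, -, ht, hz⟩ := hmove u hu
    refine ⟨_, hz, t, ht0, (mul_le_mul_of_nonneg_left (hδ₀le C hC) ht0).trans ht, ?_⟩
    have hzu : (1 - t) • u + t • p - u = t • (p - u) := by module
    rw [hzu, norm_smul, Real.norm_of_nonneg ht0]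
    have h1 := norm_sub_le p u
    have h2 := hR p (hτΔ C hC hp)
    have h3 := hR u hu
    have h4 := le_abs_self R
    exact mul_le_mul_of_nonneg_left (by linarith) ht0
  obtain ⟨y, hy, s, hs0, hs, hys⟩ := hpull u hu
  obtain ⟨z, hz, t, ht0, ht, hzt⟩ := hpull v hv
  have hw : a • y + b • z ∈ C := hcells C hC hy hz ha hb hab
  have hwx : ‖a • y + b • z - x‖ ≤ a * (s * (2 * |R|)) + b * (t * (2 * |R|)) := by
    have : a • y + b • z - x = a • (y - u) + b • (z - v) := by rw [hx]; module
    rw [this]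
    refine (norm_add_le _ _).trans ?_
    rw [norm_smul, norm_smul, Real.norm_of_nonneg ha, Real.norm_of_nonneg hb]
    gcongr
  have e1 := (abs_le.1 (hlip x hxΔ _ (hτΔ C hC hw))).1
  have e2 := (hν'conv C hC).2 hy hz ha hb hab
  have e3 := (le_abs_self _).trans (hlip u hu y (hτΔ C hC hy))
  have e4 := (le_abs_self _).trans (hlip v hv z (hτΔ C hC hz))
  have e5 := mul_le_mul_of_nonneg_left hwx hL
  have e6 := mul_le_mul_of_nonneg_left (e3.trans (mul_le_mul_of_nonneg_left hys hL)) ha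
  have e7 := mul_le_mul_of_nonneg_left (e4.trans (mul_le_mul_of_nonneg_left hzt hL)) hb
  have hst : 0 ≤ a * s + b * t := by positivity
  simp only [smul_eq_mul] at e2 ⊢
  have hν'x : ν' x ≤ a * ν' u + b * ν' v + K * (a * s + b * t) := by
    have hKeq : K * (a * s + b * t)
        = 2 * (L * (a * (s * (2 * |R|)) + b * (t * (2 * |R|)))) + (a * s + b * t) := by
      rw [hK]; ring
    linarith
  have hνx : ν x ≤ a * ν u + b * ν v - δ₀ * (a * s + b * t) := by
    have h1 := mul_le_mul_of_nonneg_left hs ha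
    have h2 := mul_le_mul_of_nonneg_left ht hb
    have h3 : a * c C + b * c C = c C := by rw [← add_mul, hab, one_mul]
    rw [hlc C hC x hxC, hx]
    simp only [map_add, map_smul, smul_eq_mul]
    linarith
  have h1 := mul_le_mul_of_nonneg_left hν'x hε.le
  have h2 := mul_le_mul_of_nonneg_right hεK.le hst
  linarith
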